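/- Let d, n ≥ 1, 1 < q < p < ∞, and let W be a matrix A_q weight on ℝ^d. Then the maximal operator M'_{W,p} built from reducing operators is bounded from L^p(ℝ^d; ℂⁿ) to L^p(ℝ^d): there is a constant c depending only on n, d, p, q such that ‖M'_{W,p} f‖_{L^p(ℝ^d)} ≤ c · [W]_{A_q}^{1/p} · ‖f‖_{L^p(ℝ^d;ℂⁿ)} for every f ∈ L^p(ℝ^d; ℂⁿ). -/

import Mathlib

open MeasureTheory ENNReal
open scoped ComplexOrder

noncomputable section

abbrev Rd (d : ℕ) := EuclideanSpace ℝ (Fin d)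
abbrev Mat (n : ℕ) := Matrix (Fin n) (Fin n) ℂ
abbrev Vec (n : ℕ) := EuclideanSpace ℂ (Fin n)

/-- A cube in `ℝ^d` with sides parallel to the coordinate axes, given by its
lower-left corner and (positive) side length. -/
structure Cube (d : ℕ) where
  corner : Rd d
  side : ℝ
  side_pos : 0 < side

namespace Cube

/-- The underlying set of the cube. -/
def set {d : ℕ} (Q : Cube d) : Set (Rd d) :=
  {x | ∀ i, Q.corner i ≤ x i ∧ x i ≤ Q.corner i + Q.side}

/-- The concentric triple `3Q` of a cube. -/
def triple {d : ℕ} (Q : Cube d) : Set (Rd d) :=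
  {x | ∀ i, Q.corner i - Q.side ≤ x i ∧ x i ≤ Q.corner i + 2 * Q.side}

end Cube

/-- Operator norm of an `n × n` complex matrix acting on `ℂⁿ` with the Euclidean norm. -/
def opNorm {n : ℕ} (A : Mat n) : ℝ := ‖Matrix.toEuclideanCLM (𝕜 := ℂ) (n := Fin n) A‖

/-- A matrix acting on a Euclidean vector. -/
def mvec {n : ℕ} (A : Mat n) (v : Vec n) : Vec n := Matrix.toEuclideanLin A v

/-- Fractional power of a Hermitian matrix via the spectral calculus (junk value `1`
for non-Hermitian matrices). -/
def matPow {n : ℕ} (A : Mat n) (s : ℝ) : Mat n :=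
  if h : A.IsHermitian then
    (h.eigenvectorUnitary : Mat n) *
      Matrix.diagonal (fun i => ((h.eigenvalues i ^ s : ℝ) : ℂ)) *
      star (h.eigenvectorUnitary : Mat n)
  else 1

/-- A matrix weight: measurable, positive definite (hence Hermitian) a.e. -/
def IsMatrixWeight {d n : ℕ} (W : Rd d → Mat n) : Prop :=
  (∀ i j, Measurable fun x => W x i j) ∧ ∀ᵐ x : Rd d, (W x).PosDef


/-- Componentwise measurability of a `ℂⁿ`-valued function. -/
def MeasurableV {d n : ℕ} (f : Rd d → Vec n) : Prop := ∀ i, Measurable fun x => f x i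
/-- The matrix `A₁` characteristic of `W`. -/
def A1Const {d n : ℕ} (W : Rd d → Mat n) : ℝ≥0∞ :=
  ⨆ Q : Cube d,
    essSup (fun y => (volume Q.set)⁻¹ *
      ∫⁻ x in Q.set, ENNReal.ofReal (opNorm (W x * (W y)⁻¹))) (volume.restrict Q.set)

/-- The matrix `A_q` characteristic of `W`, `1 < q < ∞`. -/
def AqConst {d n : ℕ} (W : Rd d → Mat n) (q : ℝ) : ℝ≥0∞ :=
  ⨆ Q : Cube d, (volume Q.set)⁻¹ * ∫⁻ x in Q.set,
    ((volume Q.set)⁻¹ * ∫⁻ y in Q.set,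
        ENNReal.ofReal (opNorm (matPow (W x) (1/q) * matPow (W y) (-(1/q)))) ^ (q/(q-1))) ^ (q-1)

/-- Hardy–Littlewood maximal operator (over cubes) of an `ℝ≥0∞`-valued function. -/
def HLM {d : ℕ} (g : Rd d → ℝ≥0∞) (x : Rd d) : ℝ≥0∞ :=
  ⨆ (Q : Cube d) (_ : x ∈ Q.set), (volume Q.set)⁻¹ * ∫⁻ y in Q.set, g y

/-- The Fujii–Wilson `A∞` characteristic of a scalar weight `w`. -/
def AInftyConst {d : ℕ} (w : Rd d → ℝ≥0∞) : ℝ≥0∞ :=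
  ⨆ Q : Cube d, (∫⁻ x in Q.set, w x)⁻¹ * ∫⁻ x in Q.set, HLM (Q.set.indicator w) x

/-- The scalar `A_{q,∞}` characteristic of a matrix weight `W`. -/
def AqScConst {d n : ℕ} (W : Rd d → Mat n) (q : ℝ) : ℝ≥0∞ :=
  ⨆ e : Vec n, AInftyConst (fun x => (‖mvec (matPow (W x) (1/q)) e‖₊ : ℝ≥0∞) ^ q)

/-- `L^p` norm of an `ℝ≥0∞`-valued function. -/
def lpNormE {d : ℕ} (p : ℝ) (g : Rd d → ℝ≥0∞) : ℝ≥0∞ := (∫⁻ x, g x ^ p) ^ (1/p)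

/-- `L^p` norm of a `ℂⁿ`-valued function. -/
def lpNormV {d n : ℕ} (p : ℝ) (f : Rd d → Vec n) : ℝ≥0∞ :=
  (∫⁻ x, (‖f x‖₊ : ℝ≥0∞) ^ p) ^ (1/p)

/-- The weighted norm `‖f‖_{L^p(W)}`. -/
def lpWNorm {d n : ℕ} (p : ℝ) (W : Rd d → Mat n) (f : Rd d → Vec n) : ℝ≥0∞ :=
  (∫⁻ x, (‖mvec (matPow (W x) (1/p)) (f x)‖₊ : ℝ≥0∞) ^ p) ^ (1/p)


/-- The averaging norm `ρ_{W,p,Q}` whose reducing operator is `𝒲_{Q,p}`. -/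
def reducingNorm {d n : ℕ} (W : Rd d → Mat n) (p : ℝ) (Q : Cube d) (e : Vec n) : ℝ≥0∞ :=
  ((volume Q.set)⁻¹ * ∫⁻ t in Q.set, (‖mvec (matPow (W t) (1/p)) e‖₊ : ℝ≥0∞) ^ p) ^ (1/p)

/-- `R` is a family of reducing operators for `W`, `p`. -/
def IsReducingFamily {d n : ℕ} (W : Rd d → Mat n) (p : ℝ) (R : Cube d → Mat n) : Prop :=
  ∀ Q : Cube d, (R Q).PosDef ∧ ∀ e : Vec n,
    reducingNorm W p Q e ≤ (‖mvec (R Q) e‖₊ : ℝ≥0∞) ∧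
    (‖mvec (R Q) e‖₊ : ℝ≥0∞) ≤ ENNReal.ofReal (Real.sqrt n) * reducingNorm W p Q e

/-- The maximal operator `M'_{W,p}` built from the reducing operators `R Q = 𝒲_{Q,p}`. -/
def MWpPrime {d n : ℕ} (R : Cube d → Mat n) (W : Rd d → Mat n) (p : ℝ)
    (f : Rd d → Vec n) (x : Rd d) : ℝ≥0∞ :=
  ⨆ (Q : Cube d) (_ : x ∈ Q.set),
    (volume Q.set)⁻¹ *
      ∫⁻ y in Q.set, (‖mvec (R Q * matPow (W y) (-(1/p))) (f y)‖₊ : ℝ≥0∞)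


namespace Cube

variable {d : ℕ}

lemma set_eq_preimage (Q : Cube d) :
    Q.set = (WithLp.ofLp : Rd d → Fin d → ℝ) ⁻¹'
      Set.Icc (fun i => Q.corner i) (fun i => Q.corner i + Q.side) := by
  ext x
  simp [Cube.set, Set.mem_Icc, Pi.le_def, forall_and]

lemma volume_set (Q : Cube d) : volume Q.set = ENNReal.ofReal Q.side ^ d := by
  rw [set_eq_preimage,
    (PiLp.volume_preserving_ofLp (Fin d)).measure_preimage measurableSet_Icc.nullMeasurableSet,
    Real.volume_Icc_pi]
  simp

lemma isClosed_set (Q : Cube d) : IsClosed Q.set := by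
  have : Q.set = ⋂ i, {x : Rd d | Q.corner i ≤ x i ∧ x i ≤ Q.corner i + Q.side} := by
    ext x; simp [Cube.set]
  rw [this]
  refine isClosed_iInter fun i => ?_
  have hi : Continuous fun x : Rd d => x i := by fun_prop
  exact (isClosed_le continuous_const hi).inter (isClosed_le hi continuous_const)

lemma measurableSet_set (Q : Cube d) : MeasurableSet Q.set := Q.isClosed_set.measurableSet

lemma volume_set_ne_zero (Q : Cube d) : volume Q.set ≠ 0 := by
  rw [volume_set]; exact pow_ne_zero _ (by simpa using Q.side_pos)

lemma volume_set_ne_top (Q : Cube d) : volume Q.set ≠ ⊤ := by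
  rw [volume_set]; exact ENNReal.pow_ne_top ENNReal.ofReal_ne_top

lemma nonempty_interior_set (Q : Cube d) : (interior Q.set).Nonempty := by
  have hsub : {x : Rd d | ∀ i, Q.corner i < x i ∧ x i < Q.corner i + Q.side} ⊆ Q.set :=
    fun x hx i => ⟨(hx i).1.le, (hx i).2.le⟩
  have hopen : IsOpen {x : Rd d | ∀ i, Q.corner i < x i ∧ x i < Q.corner i + Q.side} := by
    simp only [Set.ofPred_forall]
    refine isOpen_iInter_of_finite fun i => ?_
    have hi : Continuous fun x : Rd d => x i := by fun_prop
    exact (isOpen_lt continuous_const hi).inter (isOpen_lt hi continuous_const)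
  refine ⟨WithLp.toLp 2 fun i => Q.corner i + Q.side / 2, interior_maximal hsub hopen ?_⟩
  intro i
  have := Q.side_pos
  constructor <;> simp <;> linarith

/-- The concentric cube whose side is longer by `2 * r`. -/
def enlarge (Q : Cube d) (r : ℝ) (hr : 0 ≤ r) : Cube d where
  corner := WithLp.toLp 2 fun i => Q.corner i - r
  side := Q.side + 2 * r
  side_pos := by have := Q.side_pos; linarith

lemma mem_enlarge {Q : Cube d} {r : ℝ} {hr : 0 ≤ r} {x y : Rd d} (hx : x ∈ Q.set)
    (h : ∀ i, |y i - x i| ≤ r) : y ∈ (Q.enlarge r hr).set := by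
  intro i
  have h1 := hx i
  have h2 := abs_le.1 (h i)
  simp only [enlarge]
  constructor <;> linarith

lemma set_subset_enlarge (Q : Cube d) {r : ℝ} (hr : 0 ≤ r) : Q.set ⊆ (Q.enlarge r hr).set :=
  fun x hx => mem_enlarge hx fun i => by simpa using hr

lemma abs_sub_le_side {Q : Cube d} {x y : Rd d} (hx : x ∈ Q.set) (hy : y ∈ Q.set) (i : Fin d) :
    |y i - x i| ≤ Q.side := by
  have h1 := hx i
  have h2 := hy i
  rw [abs_le]
  constructor <;> linarith

end Cube

section Maximal

variable {d : ℕ}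

lemma lt_HLM_iff {g : Rd d → ℝ≥0∞} {x : Rd d} {l : ℝ≥0∞} :
    l < HLM g x ↔ ∃ Q : Cube d, x ∈ Q.set ∧ l < (volume Q.set)⁻¹ * ∫⁻ y in Q.set, g y := by
  simp [HLM, lt_iSup_iff]

lemma isOpen_lt_HLM (g : Rd d → ℝ≥0∞) (l : ℝ≥0∞) : IsOpen {x | l < HLM g x} := by
  rw [Metric.isOpen_iff]
  intro x hx
  obtain ⟨Q, hxQ, hQ⟩ := lt_HLM_iff.1 hx
  set I := ∫⁻ y in Q.set, g y
  have htend : Filter.Tendsto (fun ε : ℝ => (ENNReal.ofReal (Q.side + 2 * ε) ^ d)⁻¹ * I)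
      (nhdsWithin 0 (Set.Ioi 0)) (nhds ((ENNReal.ofReal (Q.side + 2 * 0) ^ d)⁻¹ * I)) := by
    refine ENNReal.Tendsto.mul_const ?_ (Or.inl ?_)
    · refine Filter.Tendsto.mono_left ?_ nhdsWithin_le_nhds
      refine (tendsto_inv_iff.2 ?_)
      refine ENNReal.Tendsto.pow ?_
      refine (ENNReal.continuous_ofReal.comp (by fun_prop : Continuous fun ε : ℝ =>
        Q.side + 2 * ε)).tendsto 0
    · exact ENNReal.inv_ne_zero.2 (ENNReal.pow_ne_top ENNReal.ofReal_ne_top)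
  rw [mul_zero, add_zero, ← Cube.volume_set] at htend
  obtain ⟨ε, hε, hpos⟩ := ((htend.eventually (lt_mem_nhds hQ)).and self_mem_nhdsWithin).exists
  have hpos : 0 < ε := hpos
  refine ⟨ε, hpos, fun y hy => lt_HLM_iff.2 ⟨Q.enlarge ε hpos.le, ?_, ?_⟩⟩
  · refine Cube.mem_enlarge hxQ fun i => ?_
    have h2 : ‖(y - x) i‖ ≤ ‖y - x‖ := PiLp.norm_apply_le _ _
    have h3 : ‖y - x‖ < ε := by simpa [dist_eq_norm] using hy
    simpa using h2.trans h3.le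
  · rw [Cube.volume_set]
    refine hε.trans_le ?_
    gcongr
    · exact le_rfl
    · exact lintegral_mono_set (Q.set_subset_enlarge hpos.le)

lemma measurable_HLM (g : Rd d → ℝ≥0∞) : Measurable (HLM g) :=
  measurable_of_Ioi fun l => (isOpen_lt_HLM g l).measurableSet

/-- The weak type `(1, 1)` bound for the Hardy–Littlewood maximal operator. -/
lemma volume_lt_HLM_le (hd : 1 ≤ d) (g : Rd d → ℝ≥0∞) {l : ℝ≥0∞} (hl : l ≠ 0) (hl' : l ≠ ⊤) :
    volume {x | l < HLM g x} ≤ 5 ^ d * l⁻¹ * ∫⁻ x, g x := by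
  by_cases hI : ∫⁻ x, g x = ⊤
  · rw [hI, ENNReal.mul_top]
    · exact le_top
    · exact mul_ne_zero (pow_ne_zero _ (by norm_num)) (ENNReal.inv_ne_zero.2 hl')
  set t : Set (Cube d) := {Q | l < (volume Q.set)⁻¹ * ∫⁻ y in Q.set, g y}
  have hvol : ∀ Q ∈ t, volume Q.set ≤ l⁻¹ * ∫⁻ y in Q.set, g y := by
    intro Q hQ
    have hQ : l < (volume Q.set)⁻¹ * ∫⁻ y in Q.set, g y := hQ
    rw [mul_comm, ← div_eq_mul_inv, ENNReal.le_div_iff_mul_le (Or.inl hl) (Or.inl hl')]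
    rw [mul_comm, ← div_eq_mul_inv] at hQ
    have := (ENNReal.lt_div_iff_mul_lt (Or.inl Q.volume_set_ne_zero)
      (Or.inl Q.volume_set_ne_top)).1 hQ
    rw [mul_comm]
    exact this.le
  have hside : ∀ Q ∈ t, Q.side ≤ max 1 (l⁻¹ * ∫⁻ y, g y).toReal := by
    intro Q hQ
    by_cases h1 : Q.side ≤ 1
    · exact h1.trans (le_max_left _ _)
    refine le_trans ?_ (le_max_right _ _)
    have h2 : Q.side ≤ Q.side ^ d := le_self_pow₀ (not_le.1 h1).le (by lia)
    refine h2.trans ?_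
    have h3 : ENNReal.ofReal (Q.side ^ d) ≤ l⁻¹ * ∫⁻ y, g y := by
      rw [ENNReal.ofReal_pow Q.side_pos.le, ← Q.volume_set]
      refine (hvol Q hQ).trans ?_
      gcongr
      exact Measure.restrict_le_self
    exact (ENNReal.ofReal_le_iff_le_toReal
      (ENNReal.mul_ne_top (ENNReal.inv_ne_top.2 hl) hI)).1 h3
  obtain ⟨u, hut, hdisj, hcov⟩ := Vitali.exists_disjoint_subfamily_covering_enlargement
    (fun Q : Cube d => Q.set) t (fun Q => Q.side) 2 (by norm_num) (fun Q _ => Q.side_pos.le) _ hside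
    (fun Q _ => Q.nonempty_interior_set.mono interior_subset)
  have hcount : u.Countable :=
    hdisj.countable_of_nonempty_interior fun Q _ => Q.nonempty_interior_set
  have hsub : {x | l < HLM g x} ⊆
      ⋃ Q ∈ u, (Q.enlarge (2 * Q.side) (by have := Q.side_pos; linarith)).set := by
    intro x hx
    obtain ⟨P, hxP, hP⟩ := lt_HLM_iff.1 hx
    obtain ⟨Q, hQu, ⟨z, hzP, hzQ⟩, hside⟩ := hcov P hP
    refine Set.mem_biUnion hQu ?_
    exact Cube.mem_enlarge hzQ fun i => (Cube.abs_sub_le_side hzP hxP i).trans hside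
  calc volume {x | l < HLM g x}
      ≤ ∑' Q : u, volume ((Q : Cube d).enlarge (2 * (Q : Cube d).side)
          (by have := (Q : Cube d).side_pos; linarith)).set :=
        (measure_mono hsub).trans (measure_biUnion_le _ hcount _)
    _ ≤ ∑' Q : u, 5 ^ d * l⁻¹ * ∫⁻ y in (Q : Cube d).set, g y := by
        refine ENNReal.tsum_le_tsum fun Q => ?_
        have : volume ((Q : Cube d).enlarge (2 * (Q : Cube d).side)
          (by have := (Q : Cube d).side_pos; linarith)).set = 5 ^ d * volume (Q : Cube d).set := by
          rw [Cube.volume_set, Cube.volume_set, ← mul_pow]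
          congr 1
          have : (5 : ℝ≥0∞) = ENNReal.ofReal 5 := by norm_num
          rw [this, ← ENNReal.ofReal_mul (by norm_num)]
          congr 1
          simp only [Cube.enlarge]; ring
        rw [this, mul_assoc]
        gcongr
        exact hvol _ (hut Q.2)
    _ = 5 ^ d * l⁻¹ * ∫⁻ y in ⋃ Q ∈ u, Q.set, g y := by
        rw [ENNReal.tsum_mul_left, lintegral_biUnion hcount (fun Q _ => Q.measurableSet_set) hdisj]
    _ ≤ _ := by gcongr; exact Measure.restrict_le_self

lemma volume_lt_HLM_le_setLIntegral (hd : 1 ≤ d) {g : Rd d → NNReal} (hg : Measurable g)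
    {l : NNReal} (hl : l ≠ 0) :
    volume {x | (l : ℝ≥0∞) < HLM (fun y => g y) x} ≤
      5 ^ d * 2 * (l : ℝ≥0∞)⁻¹ * ∫⁻ x in {x | l < 2 * g x}, g x := by
  have hms : MeasurableSet {x | l < 2 * g x} := measurableSet_lt measurable_const (by fun_prop)
  set k : Rd d → ℝ≥0∞ := {x | l < 2 * g x}.indicator fun x => g x
  have hle : ∀ y, (g y : ℝ≥0∞) ≤ k y + (l / 2 : NNReal) := by
    intro y
    by_cases h : l < 2 * g y
    · have hy : y ∈ {x | l < 2 * g x} := h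
      simp [k, hy]
    · have : g y ≤ l / 2 := by
        rw [le_div_iff₀ (by norm_num), mul_comm]; exact not_lt.1 h
      exact (ENNReal.coe_le_coe.2 this).trans le_add_self
  have hsub : {x | (l : ℝ≥0∞) < HLM (fun y => g y) x} ⊆
      {x | ((l / 2 : NNReal) : ℝ≥0∞) < HLM k x} := by
    intro x hx
    obtain ⟨Q, hxQ, hQ⟩ := lt_HLM_iff.1 hx
    refine lt_HLM_iff.2 ⟨Q, hxQ, ?_⟩
    have h1 : (volume Q.set)⁻¹ * ∫⁻ y in Q.set, g y ≤
        (volume Q.set)⁻¹ * (∫⁻ y in Q.set, k y) + (l / 2 : NNReal) := by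
      calc (volume Q.set)⁻¹ * ∫⁻ y in Q.set, g y
          ≤ (volume Q.set)⁻¹ * ∫⁻ y in Q.set, (k y + (l / 2 : NNReal)) := by
            gcongr with y; exact hle y
        _ = _ := by
            rw [lintegral_add_right _ measurable_const, mul_add, lintegral_const]
            congr 1
            rw [mul_comm, mul_assoc, Measure.restrict_apply_univ,
              ENNReal.mul_inv_cancel Q.volume_set_ne_zero Q.volume_set_ne_top, mul_one]
    have h2 : ((l / 2 : NNReal) : ℝ≥0∞) + (l / 2 : NNReal) <
        (volume Q.set)⁻¹ * (∫⁻ y in Q.set, k y) + (l / 2 : NNReal) := by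
      rw [← ENNReal.coe_add, add_halves]
      exact hQ.trans_le h1
    exact lt_of_add_lt_add_right h2
  refine (measure_mono hsub).trans ((volume_lt_HLM_le hd k ?_ ENNReal.coe_ne_top).trans_eq ?_)
  · simpa using hl
  · rw [lintegral_indicator hms, mul_assoc (5 ^ d) 2]
    congr 2
    rw [ENNReal.coe_div (by norm_num), ENNReal.inv_div (by simp) (by simp)]
    rfl

lemma HLM_lt_top_ae (hd : 1 ≤ d) {g : Rd d → NNReal} (hg : Measurable g) {r : ℝ} (hr : 1 < r)
    (hfin : ∫⁻ x, (g x : ℝ≥0∞) ^ r ≠ ⊤) : ∀ᵐ x, HLM (fun y => g y) x < ⊤ := by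
  have hbound : ∀ m : ℕ, volume {x | ¬ HLM (fun y => g y) x < ⊤} ≤
      5 ^ d * 2 * (∫⁻ x, (g x : ℝ≥0∞) ^ r) * (((m + 2 : ℕ) : ℝ≥0∞))⁻¹ := by
    intro m
    have h1 : {x | ¬ HLM (fun y => g y) x < ⊤} ⊆
        {x | (((m + 2 : ℕ) : NNReal) : ℝ≥0∞) < HLM (fun y => g y) x} := by
      intro x hx
      have hx : ¬ HLM (fun y => (g y : ℝ≥0∞)) x < ⊤ := hx
      rw [not_lt, top_le_iff] at hx
      rw [Set.mem_ofPred_eq, hx]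
      exact ENNReal.coe_lt_top
    refine (measure_mono h1).trans ((volume_lt_HLM_le_setLIntegral hd hg
      (l := ((m + 2 : ℕ) : NNReal)) (by positivity)).trans ?_)
    have hms : MeasurableSet {x | ((m + 2 : ℕ) : NNReal) < 2 * g x} :=
      measurableSet_lt measurable_const (by fun_prop)
    have h2 : ∫⁻ x in {x | ((m + 2 : ℕ) : NNReal) < 2 * g x}, g x ≤
        ∫⁻ x, (g x : ℝ≥0∞) ^ r := by
      refine (setLIntegral_mono' hms fun x hx => ?_).trans (setLIntegral_le_lintegral _ _)
      have hx : ((m + 2 : ℕ) : NNReal) < 2 * g x := hx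
      have hx1 : 1 ≤ g x := by
        by_contra h
        push Not at h
        have : ((m + 2 : ℕ) : NNReal) < 2 * 1 := hx.trans (by gcongr)
        push_cast at this
        exact absurd this (by simp)
      calc (g x : ℝ≥0∞) = (g x : ℝ≥0∞) ^ (1 : ℝ) := (ENNReal.rpow_one _).symm
        _ ≤ _ := ENNReal.rpow_le_rpow_of_exponent_le (by exact_mod_cast hx1) hr.le
    rw [mul_right_comm (5 ^ d * 2)]
    gcongr
    norm_cast
  have htend : Filter.Tendsto (fun m : ℕ => 5 ^ d * 2 * (∫⁻ x, (g x : ℝ≥0∞) ^ r) *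
      (((m + 2 : ℕ) : ℝ≥0∞))⁻¹) Filter.atTop
      (nhds (5 ^ d * 2 * (∫⁻ x, (g x : ℝ≥0∞) ^ r) * 0)) := by
    refine ENNReal.Tendsto.const_mul ?_ (Or.inr ?_)
    · exact (Filter.tendsto_add_atTop_iff_nat 2).2 ENNReal.tendsto_inv_nat_nhds_zero
    · exact ENNReal.mul_ne_top (ENNReal.mul_ne_top (ENNReal.pow_ne_top (by norm_num))
        (by norm_num)) hfin
  rw [mul_zero] at htend
  exact le_antisymm (ge_of_tendsto' htend hbound) zero_le

/-- The Hardy–Littlewood maximal theorem: strong type `(r, r)` for `1 < r < ∞`. -/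
theorem exists_lintegral_HLM_rpow_le (hd : 1 ≤ d) {r : ℝ} (hr : 1 < r) :
    ∃ C : ℝ≥0∞, C ≠ 0 ∧ C ≠ ⊤ ∧ ∀ g : Rd d → NNReal, Measurable g →
      ∫⁻ x, HLM (fun y => g y) x ^ r ≤ C * ∫⁻ x, (g x : ℝ≥0∞) ^ r := by
  have hr1 : 0 < r - 1 := by linarith
  have hr0 : 0 < r := by linarith
  refine ⟨ENNReal.ofReal r * (5 ^ d * 2) * (ENNReal.ofReal (r - 1))⁻¹ * 2 ^ (r - 1), ?_, ?_, ?_⟩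
  · refine mul_ne_zero (mul_ne_zero (mul_ne_zero ?_ ?_) ?_) ?_
    · simpa using hr0
    · positivity
    · exact ENNReal.inv_ne_zero.2 ENNReal.ofReal_ne_top
    · simp
  · refine ENNReal.mul_ne_top (ENNReal.mul_ne_top (ENNReal.mul_ne_top ENNReal.ofReal_ne_top ?_) ?_)
      (ENNReal.rpow_ne_top_of_nonneg hr1.le (by norm_num))
    · exact ENNReal.mul_ne_top (ENNReal.pow_ne_top (by norm_num)) (by norm_num)
    · exact ENNReal.inv_ne_top.2 (by simpa using hr)
  intro g hg
  set C := ENNReal.ofReal r * (5 ^ d * 2) * (ENNReal.ofReal (r - 1))⁻¹ * 2 ^ (r - 1) with hC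
  by_cases hfin : ∫⁻ x, (g x : ℝ≥0∞) ^ r = ⊤
  · rw [hfin, ENNReal.mul_top]
    · exact le_top
    · refine mul_ne_zero (mul_ne_zero (mul_ne_zero ?_ ?_) ?_) ?_
      · simpa using hr0
      · positivity
      · exact ENNReal.inv_ne_zero.2 ENNReal.ofReal_ne_top
      · simp
  set h := HLM (fun y => (g y : ℝ≥0∞))
  have hfinite : ∀ᵐ x, h x < ⊤ := HLM_lt_top_ae hd hg hr hfin
  have hmeas : Measurable h := measurable_HLM _
  set ν : Measure (Rd d) := volume.withDensity fun x => (g x : ℝ≥0∞)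
  have hlayer : ∫⁻ x, ENNReal.ofReal ((2 * g x : ℝ) ^ (r - 1)) ∂ν =
      ENNReal.ofReal (r - 1) * ∫⁻ t in Set.Ioi 0, ν {a | t < 2 * (g a : ℝ)} *
        ENNReal.ofReal (t ^ (r - 1 - 1)) :=
    lintegral_rpow_eq_lintegral_meas_lt_mul ν (Filter.Eventually.of_forall fun x => by positivity)
      (by fun_prop) hr1
  have hν : ∫⁻ x, ENNReal.ofReal ((2 * g x : ℝ) ^ (r - 1)) ∂ν =
      2 ^ (r - 1) * ∫⁻ x, (g x : ℝ≥0∞) ^ r := by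
    rw [lintegral_withDensity_eq_lintegral_mul _ (by fun_prop) (by fun_prop),
      ← lintegral_const_mul _ (by fun_prop)]
    refine lintegral_congr fun x => ?_
    have h2 : ENNReal.ofReal ((2 * g x : ℝ) ^ (r - 1)) = (2 * (g x : ℝ≥0∞)) ^ (r - 1) := by
      rw [← ENNReal.ofReal_rpow_of_nonneg (by positivity) hr1.le,
        ENNReal.ofReal_mul (by norm_num)]
      simp
    simp only [Pi.mul_apply]
    rw [h2, ENNReal.mul_rpow_of_nonneg _ _ hr1.le, mul_left_comm]
    congr 1
    by_cases h0 : g x = 0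
    · simp [h0, hr0, hr1]
    · nth_rewrite 1 [← ENNReal.rpow_one (g x : ℝ≥0∞)]
      rw [← ENNReal.rpow_add _ _ (by simpa using h0) ENNReal.coe_ne_top]
      congr 1; ring
  have hmain : ∫⁻ x, h x ^ r = ENNReal.ofReal r * ∫⁻ t in Set.Ioi 0,
      volume {a | t < (h a).toReal} * ENNReal.ofReal (t ^ (r - 1)) := by
    rw [← lintegral_rpow_eq_lintegral_meas_lt_mul volume
      (Filter.Eventually.of_forall fun x => ENNReal.toReal_nonneg) (by fun_prop) hr0]
    refine lintegral_congr_ae ?_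
    filter_upwards [hfinite] with x hx
    rw [← ENNReal.ofReal_rpow_of_nonneg ENNReal.toReal_nonneg hr0.le, ENNReal.ofReal_toReal hx.ne]
  have hpoint : ∀ t ∈ Set.Ioi (0 : ℝ),
      volume {a | t < (h a).toReal} * ENNReal.ofReal (t ^ (r - 1)) ≤
        (5 ^ d * 2) * (ν {a | t < 2 * (g a : ℝ)} * ENNReal.ofReal (t ^ (r - 1 - 1))) := by
    intro t ht
    have ht : 0 < t := ht
    lift t to NNReal using ht.le
    have ht0 : t ≠ 0 := by rintro rfl; simp at ht
    have h1 : {a | (t : ℝ) < (h a).toReal} ⊆ {a | (t : ℝ≥0∞) < h a} := by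
      intro a ha
      have := (ENNReal.ofReal_lt_iff_lt_toReal t.2 (b := h a)
        (fun htop => by simp [htop] at ha)).2 ha
      simpa using this
    have h2 : ν {a | (t : ℝ) < 2 * (g a : ℝ)} = ∫⁻ x in {x | t < 2 * g x}, g x := by
      have : {a | (t : ℝ) < 2 * (g a : ℝ)} = {x | t < 2 * g x} := by
        ext a; simp only [Set.mem_ofPred_eq]; norm_cast
      rw [this, withDensity_apply _ (measurableSet_lt measurable_const (by fun_prop))]
    have h3 : ENNReal.ofReal ((t : ℝ) ^ (r - 1)) =
        t * ENNReal.ofReal ((t : ℝ) ^ (r - 1 - 1)) := by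
      rw [← ENNReal.ofReal_coe_nnreal (p := t)]
      rw [← ENNReal.ofReal_mul t.coe_nonneg, Real.rpow_sub_one ht.ne' (r - 1)]
      congr 1
      field_simp
    calc _ ≤ (5 ^ d * 2 * (t : ℝ≥0∞)⁻¹ * ∫⁻ x in {x | t < 2 * g x}, g x) *
          (t * ENNReal.ofReal ((t : ℝ) ^ (r - 1 - 1))) := by
            rw [h3]
            gcongr
            exact (measure_mono h1).trans (volume_lt_HLM_le_setLIntegral hd hg ht0)
      _ = ((t : ℝ≥0∞)⁻¹ * t) * (5 ^ d * 2 * (∫⁻ x in {x | t < 2 * g x}, g x) *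
          ENNReal.ofReal ((t : ℝ) ^ (r - 1 - 1))) := by ring
      _ = _ := by
            rw [ENNReal.inv_mul_cancel (by simpa using ht0) ENNReal.coe_ne_top, one_mul, h2,
              mul_assoc]
  have hinv : ENNReal.ofReal (r - 1) ≠ 0 := by simpa using hr
  have hJ : ∫⁻ t in Set.Ioi 0, ν {a | t < 2 * (g a : ℝ)} * ENNReal.ofReal (t ^ (r - 1 - 1)) =
      (ENNReal.ofReal (r - 1))⁻¹ * (2 ^ (r - 1) * ∫⁻ x, (g x : ℝ≥0∞) ^ r) := by
    rw [← hν, hlayer, ← mul_assoc, ENNReal.inv_mul_cancel hinv ENNReal.ofReal_ne_top, one_mul]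
  calc ∫⁻ x, h x ^ r ≤ ENNReal.ofReal r * ∫⁻ t in Set.Ioi 0,
        (5 ^ d * 2) * (ν {a | t < 2 * (g a : ℝ)} * ENNReal.ofReal (t ^ (r - 1 - 1))) := by
        rw [hmain]
        gcongr 1
        exact setLIntegral_mono' measurableSet_Ioi hpoint
    _ = _ := by
        rw [lintegral_const_mul' _ _ (ENNReal.mul_ne_top (ENNReal.pow_ne_top (by norm_num))
          (by norm_num)), hJ, hC]
        ring

end Maximal

section Cordes

variable {A : Type*} [CStarAlgebra A] [PartialOrder A] [StarOrderedRing A]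

lemma CFC.smul_rpow {a : A} (ha : 0 ≤ a) (c : NNReal) {y : ℝ} (hy : 0 ≤ y) :
    (c • a) ^ y = c ^ y • a ^ y := by
  have hcont : Continuous fun x : NNReal => x ^ y := NNReal.continuous_rpow_const hy
  rw [CFC.rpow_def, CFC.rpow_def, ← cfc_comp_smul c _ a hcont.continuousOn,
    ← cfc_smul (c ^ y) _ a hcont.continuousOn]
  refine cfc_congr fun x _ => ?_
  simp [NNReal.mul_rpow]

/-- A form of the Cordes inequality. -/
lemma CFC.norm_rpow_mul_rpow_neg_le {P S : A} (hP : IsStrictlyPositive P)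
    (hS : IsStrictlyPositive S) {a θ : ℝ} (ha : 0 < a) (hθ : 0 < θ) (hθ1 : θ ≤ 1) :
    ‖P ^ (a * θ) * S ^ (-(a * θ))‖ ≤ ‖P ^ a * S ^ (-a)‖ ^ θ := by
  set T := P ^ a * S ^ (-a) with hT
  have hsa (B : A) (z : ℝ) : star (B ^ z) = B ^ z :=
    (IsSelfAdjoint.of_nonneg CFC.rpow_nonneg).star_eq
  have hadd {B : A} (hB : IsStrictlyPositive B) (z : ℝ) : B ^ z * B ^ z = B ^ (2 * z) := by
    rw [two_mul, CFC.rpow_add hB.isUnit]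
  have h1 : star T * T ≤ (‖T‖₊ ^ 2 : NNReal) • (1 : A) := by
    have := CStarAlgebra.star_mul_le_algebraMap_norm_sq (a := T)
    rw [Algebra.algebraMap_eq_smul_one] at this
    exact this
  have h2 : P ^ (2 * a) ≤ (‖T‖₊ ^ 2 : NNReal) • S ^ (2 * a) := by
    have := conjugate_le_conjugate_of_nonneg h1 (CFC.rpow_nonneg (a := S) (y := a))
    have hTS : T * S ^ a = P ^ a := by
      rw [hT, mul_assoc, CFC.rpow_neg_mul_rpow a hS, mul_one]
    have hTS' : S ^ a * star T = P ^ a := by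
      rw [← hsa S a, ← star_mul, hTS, hsa]
    rw [← mul_assoc, hTS', mul_assoc, hTS, hadd hP, mul_smul_comm, mul_one, smul_mul_assoc,
      hadd hS] at this
    exact this
  have h3 : P ^ (2 * (a * θ)) ≤ ((‖T‖₊ ^ 2) ^ θ : NNReal) • S ^ (2 * (a * θ)) := by
    have := CFC.rpow_le_rpow ⟨hθ.le, hθ1⟩ h2
    rwa [CFC.smul_rpow CFC.rpow_nonneg _ hθ.le, CFC.rpow_rpow _ _ _ (by positivity) hP,
      CFC.rpow_rpow _ _ _ (by positivity) hS, mul_assoc] at this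
  set b := a * θ
  have h4 : star (P ^ b * S ^ (-b)) * (P ^ b * S ^ (-b)) ≤
      algebraMap ℝ A ((‖T‖ ^ 2) ^ θ) := by
    have := conjugate_le_conjugate_of_nonneg h3 (CFC.rpow_nonneg (a := S) (y := -b))
    rw [star_mul, hsa, hsa, mul_assoc, ← mul_assoc (P ^ b), hadd hP, ← mul_assoc]
    refine this.trans_eq ?_
    rw [mul_smul_comm, smul_mul_assoc, ← hadd hS, ← mul_assoc, CFC.rpow_neg_mul_rpow b hS, one_mul,
      CFC.rpow_mul_rpow_neg b hS, Algebra.algebraMap_eq_smul_one]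
    rfl
  have h5 := (CStarAlgebra.norm_le_iff_le_algebraMap _ (by positivity)
    (star_mul_self_nonneg (P ^ b * S ^ (-b)))).2 h4
  rw [CStarRing.norm_star_mul_self, ← pow_two, ← Real.rpow_pow_comm (norm_nonneg T)] at h5
  exact le_of_sq_le_sq h5 (by positivity)

end Cordes

section MatPow

open scoped MatrixOrder Matrix.Norms.L2Operator

variable {n : ℕ}

instance : MeasurableSpace (Mat n) := inferInstanceAs (MeasurableSpace (Fin n → Fin n → ℂ))

instance : BorelSpace (Mat n) := inferInstanceAs (BorelSpace (Fin n → Fin n → ℂ))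

lemma opNorm_eq_norm (A : Mat n) : opNorm A = ‖A‖ := rfl

lemma matPow_eq_cfc {A : Mat n} (hA : A.IsHermitian) (s : ℝ) :
    matPow A s = cfc (fun x : ℝ => x ^ s) A := by
  rw [matPow, dif_pos hA, hA.cfc_eq, Matrix.IsHermitian.cfc]
  rfl

lemma matPow_eq_rpow {A : Mat n} (hA : A.PosDef) (s : ℝ) : matPow A s = A ^ s := by
  rw [matPow_eq_cfc hA.isHermitian, CFC.rpow_eq_cfc_real hA.isStrictlyPositive.nonneg]

lemma measurableSet_isStrictlyPositive : MeasurableSet {A : Mat n | IsStrictlyPositive A} := by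
  have : {A : Mat n | IsStrictlyPositive A} = {A | 0 ≤ A} ∩ {A | IsUnit A} := by
    ext A; exact IsStrictlyPositive.iff_of_unital
  rw [this]
  exact CStarAlgebra.isClosed_nonneg.measurableSet.inter Units.isOpen.measurableSet

lemma continuousOn_rpow_isStrictlyPositive (s : ℝ) :
    ContinuousOn (fun A : Mat n => A ^ s) {A | IsStrictlyPositive A} := by
  have h0 : ∀ A : Mat n, IsStrictlyPositive A → 0 ∉ spectrum NNReal A :=
    fun A hA => spectrum.zero_notMem _ hA.isUnit
  refine continuousOn_id.cfc_nnreal_of_mem_nhdsSet (s := {0}ᶜ) _ ?_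
    (fun A hA => IsStrictlyPositive.nonneg hA) ?_
  · rw [IsOpen.mem_nhdsSet isOpen_compl_singleton]
    simpa using h0
  · intro x hx
    exact (NNReal.continuousAt_rpow_const (Or.inl hx)).continuousWithinAt

lemma opNorm_matPow_mul_matPow_neg_le {P S : Mat n} (hP : P.PosDef) (hS : S.PosDef) {q p : ℝ}
    (hq : 0 < q) (hqp : q ≤ p) :
    opNorm (matPow S (-(1 / p)) * matPow P (1 / p)) ≤
      opNorm (matPow P (1 / q) * matPow S (-(1 / q))) ^ (q / p) := by
  have hp : 0 < p := hq.trans_le hqp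
  have hsa (B : Mat n) (z : ℝ) : star (B ^ z) = B ^ z :=
    (IsSelfAdjoint.of_nonneg CFC.rpow_nonneg).star_eq
  have := CFC.norm_rpow_mul_rpow_neg_le hP.isStrictlyPositive hS.isStrictlyPositive
    (one_div_pos.2 hq) (div_pos hq hp) ((div_le_one hp).2 hqp)
  have h1 : 1 / q * (q / p) = 1 / p := by field_simp
  rw [h1, ← norm_star, star_mul, hsa, hsa] at this
  simpa only [matPow_eq_rpow hP, matPow_eq_rpow hS, opNorm_eq_norm] using this

lemma aemeasurable_matPow {d : ℕ} {W : Rd d → Mat n} (hW : IsMatrixWeight W) (s : ℝ) :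
    AEMeasurable (fun x => matPow (W x) s) := by
  classical
  have hWm : Measurable W := measurable_pi_iff.2 fun i => measurable_pi_iff.2 fun j => hW.1 i j
  have hm : Measurable (Set.piecewise {A : Mat n | IsStrictlyPositive A} (fun A => A ^ s) 1) :=
    (continuousOn_rpow_isStrictlyPositive s).measurable_piecewise continuousOn_const
      measurableSet_isStrictlyPositive
  refine ⟨_, hm.comp hWm, ?_⟩
  filter_upwards [hW.2] with x hx
  rw [matPow_eq_rpow hx, Function.comp_apply, Set.piecewise_eq_of_mem]
  exact hx.isStrictlyPositive

lemma aemeasurable_mvec_matPow {d : ℕ} {W : Rd d → Mat n} (hW : IsMatrixWeight W) (s : ℝ)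
    (v : Vec n) : AEMeasurable (fun x => mvec (matPow (W x) s) v) := by
  have hc : Continuous fun A : Mat n => mvec A v :=
    LinearMap.continuous_of_finiteDimensional
      ((LinearMap.applyₗ v).comp
        (Matrix.toEuclideanLin (𝕜 := ℂ) (m := Fin n) (n := Fin n)).toLinearMap)
  exact hc.measurable.comp_aemeasurable (aemeasurable_matPow hW s)

end MatPow

section Mvec

variable {n : ℕ}

lemma mvec_mul (A B : Mat n) (v : Vec n) : mvec (A * B) v = mvec A (mvec B v) := by
  simp [mvec]

lemma mvec_one (v : Vec n) : mvec 1 v = v := by simp [mvec]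

lemma mvec_add (A : Mat n) (v w : Vec n) : mvec A (v + w) = mvec A v + mvec A w := map_add _ _ _

lemma mvec_smul (A : Mat n) (c : ℂ) (v : Vec n) : mvec A (c • v) = c • mvec A v := map_smul _ _ _

lemma opNorm_nonneg (A : Mat n) : 0 ≤ opNorm A := norm_nonneg _

lemma norm_mvec_le (A : Mat n) (v : Vec n) : ‖mvec A v‖ ≤ opNorm A * ‖v‖ :=
  (Matrix.toEuclideanCLM (𝕜 := ℂ) (n := Fin n) A).le_opNorm v

lemma inner_mvec_left {A : Mat n} (hA : A.IsHermitian) (v w : Vec n) :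
    inner ℂ (mvec A v) w = inner ℂ v (mvec A w) := by
  exact Matrix.isSymmetric_toEuclideanLin_iff.2 hA v w

end Mvec

section MatPow
open scoped MatrixOrder Matrix.Norms.L2Operator
variable {n : ℕ}

lemma isHermitian_matPow {A : Mat n} (hA : A.PosDef) (s : ℝ) : (matPow A s).IsHermitian := by
  rw [matPow_eq_rpow hA]
  exact IsSelfAdjoint.of_nonneg CFC.rpow_nonneg

lemma matPow_mul_matPow_neg {A : Mat n} (hA : A.PosDef) (s : ℝ) :
    matPow A s * matPow A (-s) = 1 := by
  rw [matPow_eq_rpow hA, matPow_eq_rpow hA, CFC.rpow_mul_rpow_neg s hA.isStrictlyPositive]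

end MatPow

namespace Cube

variable {d : ℕ}

/-- Normalised Lebesgue measure on a cube. -/
def avgMeasure (Q : Cube d) : Measure (Rd d) := (volume Q.set)⁻¹ • volume.restrict Q.set

lemma lintegral_avgMeasure (Q : Cube d) (g : Rd d → ℝ≥0∞) :
    ∫⁻ x, g x ∂Q.avgMeasure = (volume Q.set)⁻¹ * ∫⁻ x in Q.set, g x := by
  rw [avgMeasure, lintegral_smul_measure, smul_eq_mul]

instance (Q : Cube d) : IsProbabilityMeasure Q.avgMeasure :=
  ⟨by simp [avgMeasure, ENNReal.inv_mul_cancel Q.volume_set_ne_zero Q.volume_set_ne_top]⟩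

lemma avgMeasure_absolutelyContinuous (Q : Cube d) : Q.avgMeasure ≪ volume :=
  (Measure.absolutelyContinuous_of_le Measure.restrict_le_self).smul_left _

end Cube

section Averages

variable {d n : ℕ}

/-- The inner average of the `A_q` characteristic. -/
def aqInner (W : Rd d → Mat n) (q : ℝ) (Q : Cube d) (x : Rd d) : ℝ≥0∞ :=
  (∫⁻ y, ENNReal.ofReal (opNorm (matPow (W x) (1/q) * matPow (W y) (-(1/q)))) ^ (q/(q-1))
    ∂Q.avgMeasure) ^ (q-1)

lemma lintegral_aqInner_le (W : Rd d → Mat n) (q : ℝ) (Q : Cube d) :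
    ∫⁻ x, aqInner W q Q x ∂Q.avgMeasure ≤ AqConst W q := by
  simp only [aqInner, Cube.lintegral_avgMeasure]
  exact le_iSup (fun Q : Cube d => (volume Q.set)⁻¹ * ∫⁻ x in Q.set,
    ((volume Q.set)⁻¹ * ∫⁻ y in Q.set,
        ENNReal.ofReal (opNorm (matPow (W x) (1/q) * matPow (W y) (-(1/q)))) ^ (q/(q-1))) ^ (q-1)) Q

/-- The `L^t` average of `|W^{-1/p} v|`, dual to `reducingNorm`. -/
def dualNorm (W : Rd d → Mat n) (p t : ℝ) (Q : Cube d) (v : Vec n) : ℝ≥0∞ :=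
  (∫⁻ y, (‖mvec (matPow (W y) (-(1/p))) v‖₊ : ℝ≥0∞) ^ t ∂Q.avgMeasure) ^ (1/t)

lemma dualNorm_add_le {W : Rd d → Mat n} (hW : IsMatrixWeight W) (p : ℝ) {t : ℝ} (ht : 1 ≤ t)
    (Q : Cube d) (v w : Vec n) :
    dualNorm W p t Q (v + w) ≤ dualNorm W p t Q v + dualNorm W p t Q w := by
  have hm (u : Vec n) :
      AEMeasurable (fun y => (‖mvec (matPow (W y) (-(1/p))) u‖₊ : ℝ≥0∞)) Q.avgMeasure :=
    ((aemeasurable_mvec_matPow hW _ u).mono_ac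
      Q.avgMeasure_absolutelyContinuous).nnnorm.coe_nnreal_ennreal
  refine le_trans ?_ (ENNReal.lintegral_Lp_add_le (hm v) (hm w) ht)
  refine ENNReal.rpow_le_rpow (lintegral_mono fun y => ?_) (by positivity)
  refine ENNReal.rpow_le_rpow ?_ (by positivity)
  rw [mvec_add, Pi.add_apply]
  exact_mod_cast nnnorm_add_le _ _

lemma dualNorm_smul (W : Rd d → Mat n) (p : ℝ) {t : ℝ} (ht : 0 < t) (Q : Cube d) (c : ℂ)
    (v : Vec n) : dualNorm W p t Q (c • v) = ‖c‖₊ * dualNorm W p t Q v := by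
  simp only [dualNorm, mvec_smul, nnnorm_smul, ENNReal.coe_mul,
    ENNReal.mul_rpow_of_nonneg _ _ ht.le]
  rw [lintegral_const_mul' _ _ (ENNReal.rpow_ne_top_of_nonneg ht.le ENNReal.coe_ne_top),
    ENNReal.mul_rpow_of_nonneg _ _ (by positivity), ← ENNReal.rpow_mul, mul_one_div_cancel ht.ne',
    ENNReal.rpow_one]

lemma dualNorm_matPow_le {W : Rd d → Mat n} (hW : IsMatrixWeight W) {p q : ℝ} (hq : 1 < q)
    (hqp : q < p) (Q : Cube d) {x : Rd d} (hx : (W x).PosDef) (u : Vec n) :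
    dualNorm W p (p / (q - 1)) Q (mvec (matPow (W x) (1/p)) u) ≤
      aqInner W q Q x ^ (1/p) * ‖u‖₊ := by
  have hq0 : 0 < q - 1 := by linarith
  have hp0 : 0 < p := by linarith
  have ht : 0 < p / (q - 1) := by positivity
  have hpt : ∀ᵐ y ∂Q.avgMeasure,
      (‖mvec (matPow (W y) (-(1/p))) (mvec (matPow (W x) (1/p)) u)‖₊ : ℝ≥0∞) ^ (p / (q - 1)) ≤
        ENNReal.ofReal (opNorm (matPow (W x) (1/q) * matPow (W y) (-(1/q)))) ^ (q/(q-1)) *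
          (‖u‖₊ : ℝ≥0∞) ^ (p / (q - 1)) := by
    filter_upwards [Q.avgMeasure_absolutelyContinuous.ae_le hW.2] with y hy
    have h1 : ‖mvec (matPow (W y) (-(1/p))) (mvec (matPow (W x) (1/p)) u)‖ ≤
        opNorm (matPow (W x) (1/q) * matPow (W y) (-(1/q))) ^ (q / p) * ‖u‖ := by
      rw [← mvec_mul]
      refine (norm_mvec_le _ _).trans ?_
      gcongr
      exact opNorm_matPow_mul_matPow_neg_le hx hy (by linarith) hqp.le
    have h2 : (‖mvec (matPow (W y) (-(1/p))) (mvec (matPow (W x) (1/p)) u)‖₊ : ℝ≥0∞) ≤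
        ENNReal.ofReal (opNorm (matPow (W x) (1/q) * matPow (W y) (-(1/q)))) ^ (q / p) * ‖u‖₊ := by
      have := ENNReal.ofReal_le_ofReal h1
      rwa [ENNReal.ofReal_mul (Real.rpow_nonneg (opNorm_nonneg _) _),
        ← ENNReal.ofReal_rpow_of_nonneg (opNorm_nonneg _) (by positivity), ofReal_norm,
        ofReal_norm] at this
    refine (ENNReal.rpow_le_rpow h2 ht.le).trans_eq ?_
    rw [ENNReal.mul_rpow_of_nonneg _ _ ht.le, ← ENNReal.rpow_mul]
    congr 2
    field_simp
  refine (ENNReal.rpow_le_rpow (lintegral_mono_ae hpt) (by positivity)).trans_eq ?_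
  rw [lintegral_mul_const' _ _ (ENNReal.rpow_ne_top_of_nonneg ht.le ENNReal.coe_ne_top),
    ENNReal.mul_rpow_of_nonneg _ _ (by positivity), ← ENNReal.rpow_mul, mul_one_div_cancel ht.ne',
    ENNReal.rpow_one, aqInner, ← ENNReal.rpow_mul]
  congr 2
  field_simp

/-- Hahn–Banach: every seminorm has a norming functional at each point. -/
lemma Seminorm.exists_dual_eq {E : Type*} [AddCommGroup E] [Module ℂ E] (P : Seminorm ℂ E)
    (v : E) : ∃ g : Module.Dual ℂ E, g v = (P v : ℂ) ∧ ∀ x, ‖g x‖ ≤ P x := by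
  by_cases hv : v = 0
  · exact ⟨0, by simp [hv], fun x => by simp⟩
  obtain ⟨g, hg, hgP⟩ := Module.Dual.exists_extension_of_le_seminorm (ℂ ∙ v)
    ((P v : ℂ) • (LinearEquiv.toSpanNonzeroSingleton ℂ E v hv).symm.toLinearMap) (p := P) (by
      intro x
      obtain ⟨c, rfl⟩ := (LinearEquiv.toSpanNonzeroSingleton ℂ E v hv).surjective x
      rw [LinearMap.smul_apply, LinearEquiv.coe_coe, LinearEquiv.symm_apply_apply]
      simp [map_smul_eq_mul, mul_comm, abs_of_nonneg (apply_nonneg P v)])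
  refine ⟨g, ?_, hgP⟩
  have := hg (LinearEquiv.toSpanNonzeroSingleton ℂ E v hv 1)
  rw [LinearMap.smul_apply, LinearEquiv.coe_coe, LinearEquiv.symm_apply_apply] at this
  simpa using this

lemma dualNorm_ne_top {W : Rd d → Mat n} (hW : IsMatrixWeight W) {p q : ℝ} (hq : 1 < q)
    (hqp : q < p) (hA : AqConst W q ≠ ⊤) (Q : Cube d) (v : Vec n) :
    dualNorm W p (p / (q - 1)) Q v ≠ ⊤ := by
  obtain ⟨x, hx, hxt⟩ : ∃ x, (W x).PosDef ∧ aqInner W q Q x ≠ ⊤ := by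
    by_contra! h
    refine hA (top_le_iff.1 (le_trans ?_ (lintegral_aqInner_le W q Q)))
    have : ∀ᵐ x ∂Q.avgMeasure, ⊤ ≤ aqInner W q Q x := by
      filter_upwards [Q.avgMeasure_absolutelyContinuous.ae_le hW.2] with x hx
      rw [h x hx]
    simpa using lintegral_mono_ae this
  have hv : v = mvec (matPow (W x) (1/p)) (mvec (matPow (W x) (-(1/p))) v) := by
    rw [← mvec_mul, matPow_mul_matPow_neg hx, mvec_one]
  rw [hv]
  refine ne_top_of_le_ne_top ?_ (dualNorm_matPow_le hW hq hqp Q hx _)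
  exact ENNReal.mul_ne_top (ENNReal.rpow_ne_top_of_nonneg (by
    have : 0 < p := by linarith
    positivity) hxt) ENNReal.coe_ne_top

/-- `dualNorm` as a seminorm. -/
def dualSeminorm {W : Rd d → Mat n} (hW : IsMatrixWeight W) (p : ℝ) {t : ℝ} (ht : 1 ≤ t)
    (Q : Cube d) (hfin : ∀ v, dualNorm W p t Q v ≠ ⊤) : Seminorm ℂ (Vec n) :=
  Seminorm.of (fun v => (dualNorm W p t Q v).toReal)
    (fun v w => by
      rw [← ENNReal.toReal_add (hfin v) (hfin w)]
      exact ENNReal.toReal_mono (ENNReal.add_ne_top.2 ⟨hfin v, hfin w⟩)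
        (dualNorm_add_le hW p ht Q v w))
    (fun c v => by simp [dualNorm_smul W p (zero_lt_one.trans_le ht)])

lemma exists_inner_eq_dualNorm {W : Rd d → Mat n} (hW : IsMatrixWeight W) (p : ℝ) {t : ℝ}
    (ht : 1 ≤ t) (Q : Cube d) (hfin : ∀ v, dualNorm W p t Q v ≠ ⊤) (v : Vec n) :
    ∃ a : Vec n, (‖inner ℂ a v‖₊ : ℝ≥0∞) = dualNorm W p t Q v ∧
      ∀ u, (‖inner ℂ a u‖₊ : ℝ≥0∞) ≤ dualNorm W p t Q u := by
  obtain ⟨g, hgv, hg⟩ := (dualSeminorm hW p ht Q hfin).exists_dual_eq v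
  have hP (u : Vec n) : ENNReal.ofReal (dualSeminorm hW p ht Q hfin u) = dualNorm W p t Q u :=
    ENNReal.ofReal_toReal (hfin u)
  have hin (u : Vec n) :
      inner ℂ ((InnerProductSpace.toDual ℂ (Vec n)).symm (LinearMap.toContinuousLinearMap g)) u =
        g u := by simp
  refine ⟨(InnerProductSpace.toDual ℂ (Vec n)).symm (LinearMap.toContinuousLinearMap g), ?_,
    fun u => ?_⟩
  · rw [hin, ← hP, ← enorm_eq_nnnorm, ← ofReal_norm, hgv, Complex.norm_real, 
      Real.norm_of_nonneg (apply_nonneg _ _)]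
  · rw [hin, ← hP, ← enorm_eq_nnnorm, ← ofReal_norm]
    exact ENNReal.ofReal_le_ofReal (hg u)

lemma reducingNorm_le {W : Rd d → Mat n} (hW : IsMatrixWeight W) {p q : ℝ} (hq : 1 < q)
    (hqp : q < p) (Q : Cube d) {a : Vec n}
    (ha : ∀ u, (‖inner ℂ a u‖₊ : ℝ≥0∞) ≤ dualNorm W p (p / (q - 1)) Q u) :
    reducingNorm W p Q a ≤ AqConst W q ^ (1/p) := by
  have hp0 : 0 < p := by linarith
  rw [reducingNorm, ← Cube.lintegral_avgMeasure]
  refine ENNReal.rpow_le_rpow (le_trans (lintegral_mono_ae ?_) (lintegral_aqInner_le W q Q))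
    (by positivity)
  filter_upwards [Q.avgMeasure_absolutelyContinuous.ae_le hW.2] with x hx
  set w := mvec (matPow (W x) (1/p)) a
  have h1 : (‖w‖₊ : ℝ≥0∞) * ‖w‖₊ ≤ aqInner W q Q x ^ (1/p) * ‖w‖₊ := by
    refine le_trans (le_of_eq ?_) ((ha _).trans (dualNorm_matPow_le hW hq hqp Q hx w))
    rw [← inner_mvec_left (isHermitian_matPow hx _), ← ENNReal.coe_mul]
    congr 1
    ext
    simp [w, pow_two]
  have h2 : (‖w‖₊ : ℝ≥0∞) ≤ aqInner W q Q x ^ (1/p) := by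
    by_cases hw : (‖w‖₊ : ℝ≥0∞) = 0
    · simp [hw]
    · exact (ENNReal.mul_le_mul_iff_left hw ENNReal.coe_ne_top).1 h1
  calc _ ≤ (aqInner W q Q x ^ (1/p)) ^ p := ENNReal.rpow_le_rpow h2 hp0.le
    _ = _ := by rw [← ENNReal.rpow_mul, one_div_mul_cancel hp0.ne', ENNReal.rpow_one]

lemma dualNorm_reducing_le {W : Rd d → Mat n} (hW : IsMatrixWeight W) {p q : ℝ} (hq : 1 < q)
    (hqp : q < p) (hA : AqConst W q ≠ ⊤) {R : Cube d → Mat n} (hR : IsReducingFamily W p R)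
    (Q : Cube d) (e : Vec n) :
    dualNorm W p (p / (q - 1)) Q (mvec (R Q) e) ≤
      ENNReal.ofReal (Real.sqrt n) * AqConst W q ^ (1/p) * ‖e‖₊ := by
  have ht : 1 ≤ p / (q - 1) := by rw [one_le_div] <;> linarith
  obtain ⟨a, hav, ha⟩ := exists_inner_eq_dualNorm hW p ht Q (dualNorm_ne_top hW hq hqp hA Q)
    (mvec (R Q) e)
  rw [← hav, ← inner_mvec_left (hR Q).1.isHermitian]
  calc (‖inner ℂ (mvec (R Q) a) e‖₊ : ℝ≥0∞) ≤ ‖mvec (R Q) a‖₊ * ‖e‖₊ := by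
        exact_mod_cast nnnorm_inner_le_nnnorm _ _
    _ ≤ _ := by
        gcongr
        refine ((hR Q).2 a).2.trans ?_
        gcongr
        exact reducingNorm_le hW hq hqp Q ha

end Averages

section Pointwise

variable {d n : ℕ}

lemma MeasurableV.measurable {f : Rd d → Vec n} (hf : MeasurableV f) : Measurable f :=
  (MeasurableEquiv.toLp 2 (Fin n → ℂ)).measurable.comp (measurable_pi_iff.2 hf)

lemma nnnorm_le_sum_inner_basisFun (v : Vec n) :
    ‖v‖₊ ≤ ∑ i, ‖inner ℂ (EuclideanSpace.basisFun (Fin n) ℂ i) v‖₊ := by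
  conv_lhs => rw [← (EuclideanSpace.basisFun (Fin n) ℂ).sum_repr' v]
  refine (nnnorm_sum_le _ _).trans_eq ?_
  simp [nnnorm_smul]

lemma nnnorm_mvec_mul_le_sum {A B : Mat n} (hA : A.IsHermitian) (hB : B.IsHermitian) (v : Vec n) :
    ‖mvec (A * B) v‖₊ ≤
      ∑ i, ‖mvec B (mvec A (EuclideanSpace.basisFun (Fin n) ℂ i))‖₊ * ‖v‖₊ := by
  refine (nnnorm_le_sum_inner_basisFun _).trans (Finset.sum_le_sum fun i _ => ?_)
  rw [mvec_mul, ← inner_mvec_left hA, ← inner_mvec_left hB]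
  exact nnnorm_inner_le_nnnorm _ _

lemma lintegral_mvec_reducing_le {W : Rd d → Mat n} (hW : IsMatrixWeight W) {p q : ℝ}
    (hq : 1 < q) (hqp : q < p) (hA : AqConst W q ≠ ⊤) {R : Cube d → Mat n}
    (hR : IsReducingFamily W p R) {f : Rd d → Vec n} (hf : MeasurableV f) (Q : Cube d) {s : ℝ}
    (hs : (p / (q - 1)).HolderConjugate s) :
    ∫⁻ y, (‖mvec (R Q * matPow (W y) (-(1/p))) (f y)‖₊ : ℝ≥0∞) ∂Q.avgMeasure ≤
      n * ENNReal.ofReal (Real.sqrt n) * AqConst W q ^ (1/p) *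
        (∫⁻ y, (‖f y‖₊ : ℝ≥0∞) ^ s ∂Q.avgMeasure) ^ (1/s) := by
  set b := EuclideanSpace.basisFun (Fin n) ℂ
  set F : Fin n → Rd d → ℝ≥0∞ := fun i y => ‖mvec (matPow (W y) (-(1/p))) (mvec (R Q) (b i))‖₊
  have hF (i) : AEMeasurable (F i) Q.avgMeasure :=
    ((aemeasurable_mvec_matPow hW _ _).mono_ac
      Q.avgMeasure_absolutelyContinuous).nnnorm.coe_nnreal_ennreal
  have hfm : AEMeasurable (fun y => (‖f y‖₊ : ℝ≥0∞)) Q.avgMeasure :=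
    hf.measurable.nnnorm.coe_nnreal_ennreal.aemeasurable
  calc ∫⁻ y, (‖mvec (R Q * matPow (W y) (-(1/p))) (f y)‖₊ : ℝ≥0∞) ∂Q.avgMeasure
      ≤ ∫⁻ y, ∑ i, F i y * ‖f y‖₊ ∂Q.avgMeasure := by
        refine lintegral_mono_ae ?_
        filter_upwards [Q.avgMeasure_absolutelyContinuous.ae_le hW.2] with y hy
        refine (ENNReal.coe_le_coe.2 (nnnorm_mvec_mul_le_sum (hR Q).1.isHermitian
          (isHermitian_matPow hy _) (f y))).trans_eq ?_
        push_cast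
        rfl
    _ = ∑ i, ∫⁻ y, F i y * ‖f y‖₊ ∂Q.avgMeasure :=
        lintegral_finsetSum' _ fun i _ => (hF i).mul hfm
    _ ≤ ∑ _i : Fin n, ENNReal.ofReal (Real.sqrt n) * AqConst W q ^ (1/p) *
          (∫⁻ y, (‖f y‖₊ : ℝ≥0∞) ^ s ∂Q.avgMeasure) ^ (1/s) := by
        refine Finset.sum_le_sum fun i _ => ?_
        refine (ENNReal.lintegral_mul_le_Lp_mul_Lq _ hs (hF i) hfm).trans ?_
        gcongr
        have hb : ‖b i‖₊ = 1 := by ext; exact b.norm_eq_one i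
        have h := dualNorm_reducing_le hW hq hqp hA hR Q (b i)
        rwa [hb, ENNReal.coe_one, mul_one] at h
    _ = _ := by simp [mul_assoc]

lemma MWpPrime_le_HLM {W : Rd d → Mat n} (hW : IsMatrixWeight W) {p q : ℝ}
    (hq : 1 < q) (hqp : q < p) (hA : AqConst W q ≠ ⊤) {R : Cube d → Mat n}
    (hR : IsReducingFamily W p R) {f : Rd d → Vec n} (hf : MeasurableV f) {s : ℝ}
    (hs : (p / (q - 1)).HolderConjugate s) (x : Rd d) :
    MWpPrime R W p f x ≤ n * ENNReal.ofReal (Real.sqrt n) * AqConst W q ^ (1/p) *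
      HLM (fun y => (‖f y‖₊ : ℝ≥0∞) ^ s) x ^ (1/s) := by
  refine iSup₂_le fun Q hQ => ?_
  rw [← Cube.lintegral_avgMeasure]
  refine (lintegral_mvec_reducing_le hW hq hqp hA hR hf Q hs).trans ?_
  have hs0 : 0 ≤ 1 / s := hs.symm.one_div_nonneg
  rw [Cube.lintegral_avgMeasure]
  gcongr
  exact le_iSup₂ (f := fun (Q : Cube d) (_ : x ∈ Q.set) =>
    (volume Q.set)⁻¹ * ∫⁻ y in Q.set, (‖f y‖₊ : ℝ≥0∞) ^ s) Q hQ

end Pointwise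

/-- `A_q` bound for the maximal operator `M'_{W,p}` built from reducing operators. -/
theorem aq_bound_MWpPrime (d n : ℕ) (hd : 1 ≤ d) (hn : 1 ≤ n) (p q : ℝ) (hq : 1 < q)
    (hqp : q < p) :
    ∃ c : ℝ≥0∞, 0 < c ∧ c ≠ ⊤ ∧
      ∀ W : Rd d → Mat n, IsMatrixWeight W → AqConst W q ≠ ⊤ →
        ∀ R : Cube d → Mat n, IsReducingFamily W p R →
          ∀ f : Rd d → Vec n, MeasurableV f → lpNormV p f ≠ ⊤ →
            lpNormE p (MWpPrime R W p f) ≤ c * AqConst W q ^ (1/p) * lpNormV p f := by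
  have hr : 1 < p - q + 1 := by linarith
  have hp0 : 0 < p := by linarith
  have hq0 : 0 < q - 1 := by linarith
  obtain ⟨C, hC0, hCtop, hC⟩ := exists_lintegral_HLM_rpow_le hd hr
  have hn0 : (n : ℝ≥0∞) ≠ 0 := by exact_mod_cast (by omega : n ≠ 0)
  set s := p / (p - q + 1) with hs
  have hs0 : 0 < s := by positivity
  have hconj : (p / (q - 1)).HolderConjugate s := by
    rw [Real.holderConjugate_iff]
    refine ⟨by rw [one_lt_div hq0]; linarith, ?_⟩
    rw [hs]
    field_simp
    ring
  refine ⟨n * ENNReal.ofReal (Real.sqrt n) * C ^ (1/p), ?_, ?_, ?_⟩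
  · have hsqrt : 0 < Real.sqrt n := Real.sqrt_pos.2 (by exact_mod_cast hn)
    have hCp : 0 < C ^ (1/p) := ENNReal.rpow_pos (pos_iff_ne_zero.2 hC0) hCtop
    exact ENNReal.mul_pos (mul_ne_zero hn0 (ENNReal.ofReal_pos.2 hsqrt).ne') hCp.ne'
  · exact ENNReal.mul_ne_top (ENNReal.mul_ne_top (ENNReal.natCast_ne_top n) ENNReal.ofReal_ne_top)
      (ENNReal.rpow_ne_top_of_nonneg (by positivity) hCtop)
  intro W hW hA R hR f hf _
  set K := n * ENNReal.ofReal (Real.sqrt n) * AqConst W q ^ (1/p)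
  have hK : K ≠ ⊤ :=
    ENNReal.mul_ne_top (ENNReal.mul_ne_top (ENNReal.natCast_ne_top n) ENNReal.ofReal_ne_top)
      (ENNReal.rpow_ne_top_of_nonneg (by positivity) hA)
  have hHL := hC (fun y => ‖f y‖₊ ^ s) (hf.measurable.nnnorm.pow_const s)
  simp only [ENNReal.coe_rpow_of_nonneg _ hs0.le, ← ENNReal.rpow_mul] at hHL
  have hsr : s * (p - q + 1) = p := by rw [hs]; field_simp
  have hsp : 1 / s * p = p - q + 1 := by rw [hs]; field_simp
  rw [hsr] at hHL
  have hint : ∫⁻ x, MWpPrime R W p f x ^ p ≤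
      K ^ p * (C * ∫⁻ x, (‖f x‖₊ : ℝ≥0∞) ^ p) := by
    calc ∫⁻ x, MWpPrime R W p f x ^ p
        ≤ ∫⁻ x, K ^ p * HLM (fun y => (‖f y‖₊ : ℝ≥0∞) ^ s) x ^ (p - q + 1) := by
          refine lintegral_mono fun x => ?_
          refine (ENNReal.rpow_le_rpow (MWpPrime_le_HLM hW hq hqp hA hR hf hconj x)
            hp0.le).trans_eq ?_
          rw [ENNReal.mul_rpow_of_nonneg _ _ hp0.le, ← ENNReal.rpow_mul, hsp]
      _ = K ^ p * ∫⁻ x, HLM (fun y => (‖f y‖₊ : ℝ≥0∞) ^ s) x ^ (p - q + 1) :=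
          lintegral_const_mul' _ _ (ENNReal.rpow_ne_top_of_nonneg hp0.le hK)
      _ ≤ _ := by gcongr
  have hp1 : 0 ≤ 1 / p := by positivity
  calc lpNormE p (MWpPrime R W p f)
      ≤ (K ^ p * (C * ∫⁻ x, (‖f x‖₊ : ℝ≥0∞) ^ p)) ^ (1/p) := ENNReal.rpow_le_rpow hint hp1
    _ = K * (C ^ (1/p) * lpNormV p f) := by
        rw [ENNReal.mul_rpow_of_nonneg _ _ hp1, ENNReal.mul_rpow_of_nonneg _ _ hp1,
          ← ENNReal.rpow_mul, mul_one_div_cancel hp0.ne', ENNReal.rpow_one, lpNormV]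
    _ = _ := by ring

end
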